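/- Let b(n) denote the number of pairs (λ, μ) where λ is a partition into odd parts with every part size occurring at most three times, μ is a partition with every part size occurring at most three times, and |λ| + |μ| = n. Then for every natural number n, b(2n) = Σ_{i=0}^{n} b(i) · b(n − i); that is, the sequence (b(n)) is 2-convolutive. -/

import Mathlib

/-- A partition into odd parts with every part size occurring at most three times. -/
def OddPartitionMultAtMostThree (lam : Multiset ℕ) : Prop :=
  (∀ i ∈ lam, Odd i) ∧ (∀ i, lam.count i ≤ 3)

/-- A partition (into positive parts) with every part size occurring at most three times. -/
def PartitionMultAtMostThree (mu : Multiset ℕ) : Prop :=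
  (∀ i ∈ mu, 0 < i) ∧ (∀ i, mu.count i ≤ 3)

open PowerSeries Finset
open scoped PowerSeries.WithPiTopology

/-- The `q`-Pochhammer product `∏_{i=1}^{n} (1 - X^{2i})`. -/
noncomputable def qPoch (n : ℕ) : ℤ⟦X⟧ := ∏ i ∈ range n, (1 - X ^ (2 * (i + 1)))

/-- The Gaussian binomial coefficients with base `X²`. -/
noncomputable def gaussBinom : ℕ → ℕ → ℤ⟦X⟧
  | _, 0 => 1
  | 0, _ + 1 => 0
  | m + 1, j + 1 => X ^ (2 * (j + 1)) * gaussBinom m (j + 1) + gaussBinom m j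

lemma gaussBinom_zero_right (m : ℕ) : gaussBinom m 0 = 1 := by cases m <;> rfl

lemma gaussBinom_eq_zero {m j : ℕ} (h : m < j) : gaussBinom m j = 0 := by
  induction m generalizing j with
  | zero =>
    obtain ⟨j, rfl⟩ := Nat.exists_eq_succ_of_ne_zero h.ne'
    rfl
  | succ m ih =>
    obtain ⟨j, rfl⟩ := Nat.exists_eq_succ_of_ne_zero (by omega : j ≠ 0)
    simp [gaussBinom, ih (show m < j + 1 by omega), ih (show m < j by omega)]

lemma gaussBinom_self (m : ℕ) : gaussBinom m m = 1 := by
  induction m with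
  | zero => rfl
  | succ m ih => simp [gaussBinom, ih, gaussBinom_eq_zero]

lemma qPoch_succ (n : ℕ) : qPoch (n + 1) = qPoch n * (1 - X ^ (2 * (n + 1))) :=
  prod_range_succ _ _

lemma gaussBinom_mul_qPoch (a b : ℕ) :
    gaussBinom (a + b) a * qPoch a * qPoch b = qPoch (a + b) := by
  induction a generalizing b with
  | zero => simp [gaussBinom_zero_right, qPoch]
  | succ a iha =>
    induction b with
    | zero => simp [gaussBinom_self, qPoch]
    | succ b ihb =>
      have h1 := iha (b + 1)
      have e : a + 1 + (b + 1) = (a + 1 + b) + 1 := by ring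
      have e' : a + (b + 1) = a + 1 + b := by ring
      rw [e'] at h1
      rw [e, gaussBinom, qPoch_succ (a + 1 + b)]
      calc _ = X ^ (2 * (a + 1)) * (1 - X ^ (2 * (b + 1))) *
              (gaussBinom (a + 1 + b) (a + 1) * qPoch (a + 1) * qPoch b) +
            (1 - X ^ (2 * (a + 1))) * (gaussBinom (a + 1 + b) a * qPoch a * qPoch (b + 1)) := by
              rw [qPoch_succ b, qPoch_succ a]; ring
        _ = _ := by rw [ihb, h1]; ring

/-- The finite `q`-binomial theorem. -/
lemma prod_add_mul_X_pow (m : ℕ) (y z : ℤ⟦X⟧) :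
    ∏ i ∈ range m, (y + z * X ^ (2 * i + 1)) =
      ∑ j ∈ range (m + 1), X ^ (j ^ 2) * gaussBinom m j * z ^ j * y ^ (m - j) := by
  induction m generalizing z with
  | zero => simp [gaussBinom]
  | succ m ih =>
    have h : ∀ i, y + z * X ^ (2 * (i + 1) + 1) = y + (z * X ^ 2) * X ^ (2 * i + 1) := by
      intro i; ring
    rw [prod_range_succ']
    simp_rw [h]
    rw [ih, sum_range_succ' _ (m + 1)]
    have h0 : ∀ j, (X : ℤ⟦X⟧) ^ ((j + 1) ^ 2) * gaussBinom (m + 1) (j + 1) * z ^ (j + 1) *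
          y ^ (m + 1 - (j + 1)) =
        X ^ ((j + 1) ^ 2) * (X ^ (2 * (j + 1)) * gaussBinom m (j + 1)) * z ^ (j + 1) *
          y ^ (m + 1 - (j + 1)) +
        X ^ ((j + 1) ^ 2) * gaussBinom m j * z ^ (j + 1) * y ^ (m + 1 - (j + 1)) := by
      intro j; rw [gaussBinom]; ring
    simp_rw [h0]
    rw [sum_add_distrib, gaussBinom_zero_right]
    have h1 : ∑ j ∈ range (m + 1), X ^ ((j + 1) ^ 2) * (X ^ (2 * (j + 1)) * gaussBinom m (j + 1)) *
          z ^ (j + 1) * y ^ (m + 1 - (j + 1)) + X ^ (0 ^ 2) * 1 * z ^ 0 * y ^ (m + 1 - 0) =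
        y * ∑ j ∈ range (m + 1), X ^ (j ^ 2) * gaussBinom m j * (z * X ^ 2) ^ j * y ^ (m - j) := by
      rw [sum_range_succ, gaussBinom_eq_zero (Nat.lt_succ_self m), sum_range_succ' _ m, mul_add y,
        mul_sum]
      simp only [mul_zero, zero_mul, add_zero]
      congr 1
      · refine sum_congr rfl fun j hj => ?_
        have : m + 1 - (j + 1) = (m - (j + 1)) + 1 := by have := mem_range.1 hj; omega
        rw [this]; ring
      · simp [gaussBinom_zero_right, pow_succ']
    have h2 : ∑ j ∈ range (m + 1), X ^ ((j + 1) ^ 2) * gaussBinom m j *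
          z ^ (j + 1) * y ^ (m + 1 - (j + 1)) =
        (z * X) * ∑ j ∈ range (m + 1),
          X ^ (j ^ 2) * gaussBinom m j * (z * X ^ 2) ^ j * y ^ (m - j) := by
      rw [mul_sum]
      refine sum_congr rfl fun j hj => ?_
      rw [Nat.add_sub_add_right]; ring
    rw [add_right_comm, h1, h2]
    ring

/-- A finite form of the Jacobi triple product at `z = -1`. -/
lemma prod_one_sub_X_odd_sq (n : ℕ) :
    (∏ i ∈ range n, (1 - X ^ (2 * i + 1) : ℤ⟦X⟧)) ^ 2 =
      ∑ j ∈ range (2 * n + 1),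
        (-1) ^ (n + j) * X ^ (((n : ℤ) - j).natAbs ^ 2) * gaussBinom (2 * n) j := by
  have key := prod_add_mul_X_pow (2 * n) (X ^ (2 * n)) (-1)
  have hl : ∏ i ∈ range (2 * n), ((X : ℤ⟦X⟧) ^ (2 * n) + -1 * X ^ (2 * i + 1)) =
      (-1) ^ n * X ^ (3 * n ^ 2) * (∏ i ∈ range n, (1 - X ^ (2 * i + 1) : ℤ⟦X⟧)) ^ 2 := by
    have ha : ∏ i ∈ range n, ((X : ℤ⟦X⟧) ^ (2 * n) + -1 * X ^ (2 * i + 1)) =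
        (-1) ^ n * X ^ (n ^ 2) * ∏ i ∈ range n, (1 - X ^ (2 * i + 1) : ℤ⟦X⟧) := by
      have hs : ∏ i ∈ range n, (X : ℤ⟦X⟧) ^ (2 * i + 1) = X ^ (n ^ 2) := by
        rw [prod_pow_eq_pow_sum]
        congr 1
        clear key
        induction n with
        | zero => rfl
        | succ n ih => rw [sum_range_succ, ih]; ring
      have hn : ∏ i ∈ range n, (-1 : ℤ⟦X⟧) = (-1) ^ n := by simp
      rw [← prod_range_reflect (fun i => (1 - X ^ (2 * i + 1) : ℤ⟦X⟧)), ← hs, ← hn,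
        ← prod_mul_distrib, ← prod_mul_distrib]
      refine prod_congr rfl fun i hi => ?_
      have : 2 * n = (2 * i + 1) + (2 * (n - 1 - i) + 1) := by
        have := mem_range.1 hi; omega
      rw [this]
      simp only [pow_add]
      have : n - 1 - i = n - (i + 1) := by omega
      ring
    have hb : ∏ i ∈ range n, ((X : ℤ⟦X⟧) ^ (2 * n) + -1 * X ^ (2 * (n + i) + 1)) =
        X ^ (2 * n ^ 2) * ∏ i ∈ range n, (1 - X ^ (2 * i + 1) : ℤ⟦X⟧) := by
      have hs : (X : ℤ⟦X⟧) ^ (2 * n ^ 2) = ∏ i ∈ range n, (X : ℤ⟦X⟧) ^ (2 * n) := by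
        rw [prod_const, card_range, ← pow_mul]; congr 1; ring
      rw [hs, ← prod_mul_distrib]
      exact prod_congr rfl fun i _ => by ring
    rw [two_mul n, prod_range_add, ← two_mul, ha, hb]
    ring
  have hr : ∑ j ∈ range (2 * n + 1), X ^ (j ^ 2) * gaussBinom (2 * n) j * (-1) ^ j *
        (X ^ (2 * n)) ^ (2 * n - j) =
      (-1) ^ n * X ^ (3 * n ^ 2) * ∑ j ∈ range (2 * n + 1),
        (-1) ^ (n + j) * X ^ (((n : ℤ) - j).natAbs ^ 2) * gaussBinom (2 * n) j := by
    rw [mul_sum]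
    refine sum_congr rfl fun j hj => ?_
    have hj' : j ≤ 2 * n := by have := mem_range.1 hj; omega
    have he : j ^ 2 + 2 * n * (2 * n - j) = 3 * n ^ 2 + ((n : ℤ) - j).natAbs ^ 2 := by
      zify [hj']
      rw [sq_abs]; ring
    have hsgn : ((-1 : ℤ⟦X⟧) ^ n * (-1) ^ (n + j)) = (-1) ^ j := by
      rw [pow_add, ← mul_assoc, ← mul_pow]; simp
    calc _ = X ^ (j ^ 2 + 2 * n * (2 * n - j)) * gaussBinom (2 * n) j * (-1) ^ j := by
            rw [pow_add, pow_mul X (2 * n)]; ring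
      _ = _ := by rw [he, ← hsgn, pow_add]; ring
  rw [hl, hr] at key
  refine mul_left_cancel₀ (mul_ne_zero ?_ (pow_ne_zero _ X_ne_zero)) key
  exact pow_ne_zero _ (by simp)

lemma isUnit_qPoch (n : ℕ) : IsUnit (qPoch n) := by
  rw [isUnit_iff_constantCoeff]
  simp [qPoch, map_prod]

lemma X_pow_dvd_qPoch_sub (a k : ℕ) : X ^ (2 * (a + 1)) ∣ qPoch (a + k) - qPoch a := by
  induction k with
  | zero => simp
  | succ k ih =>
    rw [← add_assoc, qPoch_succ]
    have : qPoch (a + k) * (1 - X ^ (2 * (a + k + 1))) - qPoch a =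
        (qPoch (a + k) - qPoch a) - X ^ (2 * (a + 1)) * (X ^ (2 * k) * qPoch (a + k)) := by
      ring
    rw [this]
    exact dvd_sub ih (dvd_mul_right _ _)

/-- If `c ≤ a, b, N` then `(∏_{i=1}^{N} (1 - X^{2i})) * gaussBinom (a + b) a` is congruent to `1`
modulo `X^{2c + 2}`. -/
lemma X_pow_dvd_qPoch_mul_sub_one {a b c N d : ℕ} (ha : c ≤ a) (hb : c ≤ b) (hN : c ≤ N)
    (hd : d ≤ 2 * (c + 1)) :
    (X : ℤ⟦X⟧) ^ d ∣ qPoch N * gaussBinom (a + b) a - 1 := by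
  refine (pow_dvd_pow X hd).trans ?_
  have h : ∀ {m}, c ≤ m → (X : ℤ⟦X⟧) ^ (2 * (c + 1)) ∣ qPoch m - qPoch c := by
    intro m hm
    obtain ⟨k, rfl⟩ := Nat.exists_eq_add_of_le hm
    exact X_pow_dvd_qPoch_sub c k
  have hu := (isUnit_qPoch a).mul (isUnit_qPoch b)
  rw [← hu.dvd_mul_right]
  have e : (qPoch N * gaussBinom (a + b) a - 1) * (qPoch a * qPoch b) =
      qPoch N * qPoch (a + b) - qPoch a * qPoch b := by
    rw [← gaussBinom_mul_qPoch a b]; ring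
  rw [e]
  have e2 : qPoch N * qPoch (a + b) - qPoch a * qPoch b =
      (qPoch N - qPoch c) * qPoch (a + b) + qPoch c * (qPoch (a + b) - qPoch c) -
      (qPoch a - qPoch c) * qPoch b - qPoch c * (qPoch b - qPoch c) := by ring
  rw [e2]
  exact dvd_sub (dvd_sub (dvd_add ((h hN).mul_right _) ((h (by omega)).mul_left _))
    ((h ha).mul_right _)) ((h hb).mul_left _)

lemma X_pow_dvd_finite_gauss (n : ℕ) :
    (X : ℤ⟦X⟧) ^ (2 * n + 1) ∣
      qPoch n * (∏ i ∈ range n, (1 - X ^ (2 * i + 1) : ℤ⟦X⟧)) ^ 2 -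
        ∑ j ∈ range (2 * n + 1), (-1) ^ (n + j) * X ^ (((n : ℤ) - j).natAbs ^ 2) := by
  rw [prod_one_sub_X_odd_sq, mul_sum, ← sum_sub_distrib]
  refine dvd_sum fun j hj => ?_
  have hj' : j ≤ 2 * n := by have := mem_range.1 hj; omega
  set k := ((n : ℤ) - j).natAbs with hk
  have e : qPoch n * ((-1) ^ (n + j) * X ^ (k ^ 2) * gaussBinom (2 * n) j) -
      (-1) ^ (n + j) * X ^ (k ^ 2) =
      (-1) ^ (n + j) * (X ^ (k ^ 2) * (qPoch n * gaussBinom (2 * n) j - 1)) := by ring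
  rw [e]
  refine Dvd.dvd.mul_left ?_ _
  have h := X_pow_dvd_qPoch_mul_sub_one (a := j) (b := 2 * n - j) (c := n - k) (N := n)
    (d := 2 * (n - k + 1)) (by omega) (by omega) (by omega) le_rfl
  rw [show j + (2 * n - j) = 2 * n by omega] at h
  refine (pow_dvd_pow X (?_ : 2 * n + 1 ≤ k ^ 2 + 2 * (n - k + 1))).trans
    (pow_add (X : ℤ⟦X⟧) _ _ ▸ mul_dvd_mul_left _ h)
  have hkn : k ≤ n := by omega
  obtain ⟨l, hl⟩ := Nat.exists_eq_add_of_le hkn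
  have hkl : n - k = l := by omega
  have hsq : 2 * k ≤ k ^ 2 + 1 := by simpa using two_mul_le_add_sq k 1
  omega

/-- The theta series `φ(-q) = ∑_{k ∈ ℤ} (-1)^k q^{k²}`. -/
noncomputable def thetaNeg : ℤ⟦X⟧ :=
  mk fun d => if d = 0 then 1 else if IsSquare d then 2 * (-1) ^ d else 0

lemma sum_range_theta_succ (n : ℕ) :
    ∑ j ∈ range (2 * (n + 1) + 1),
        (-1 : ℤ⟦X⟧) ^ (n + 1 + j) * X ^ ((((n + 1 : ℕ) : ℤ) - j).natAbs ^ 2) =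
      ∑ j ∈ range (2 * n + 1), (-1 : ℤ⟦X⟧) ^ (n + j) * X ^ (((n : ℤ) - j).natAbs ^ 2) +
        C (2 * (-1) ^ (n + 1)) * X ^ ((n + 1) ^ 2) := by
  rw [show 2 * (n + 1) + 1 = (2 * n + 1) + 1 + 1 by ring, sum_range_succ, sum_range_succ']
  have h0 : (((n + 1 : ℕ) : ℤ) - (0 : ℕ)).natAbs = n + 1 := by omega
  have h1 : (((n + 1 : ℕ) : ℤ) - (2 * n + 1 + 1 : ℕ)).natAbs = n + 1 := by omega
  have h2 : ∀ j : ℕ, (((n + 1 : ℕ) : ℤ) - (j + 1 : ℕ)).natAbs = ((n : ℤ) - j).natAbs := by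
    intro j; congr 1; push_cast; ring
  have h3 : ∀ j : ℕ, (-1 : ℤ⟦X⟧) ^ (n + 1 + (j + 1)) = (-1) ^ (n + j) := by
    intro j; rw [show n + 1 + (j + 1) = (n + j) + 2 by ring, pow_add]; simp
  simp_rw [h0, h1, h2, h3]
  have h4 : (-1 : ℤ⟦X⟧) ^ (n + (2 * n + 1)) = (-1) ^ (n + 1) := by
    rw [show n + (2 * n + 1) = 2 * n + (n + 1) by ring, pow_add]; simp
  rw [h4]
  simp only [map_mul, map_pow, map_neg, map_one, map_ofNat, add_zero]
  ring

lemma coeff_sum_range_theta (n d : ℕ) :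
    coeff d (∑ j ∈ range (2 * n + 1), (-1 : ℤ⟦X⟧) ^ (n + j) * X ^ (((n : ℤ) - j).natAbs ^ 2)) =
      if d < (n + 1) ^ 2 then coeff d thetaNeg else 0 := by
  induction n with
  | zero => simp [thetaNeg, coeff_one]; grind
  | succ n ih =>
    rw [sum_range_theta_succ, map_add, ih, coeff_C_mul, coeff_X_pow]
    rcases lt_trichotomy d ((n + 1) ^ 2) with h | h | h
    · have h' : d < (n + 1 + 1) ^ 2 := h.trans (by gcongr; omega)
      simp [h, h', h.ne]
    · subst h
      have h' : (n + 1) ^ 2 < (n + 1 + 1) ^ 2 := by gcongr; omega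
      have hs : IsSquare ((n + 1) ^ 2) := ⟨n + 1, sq _⟩
      have hp : (-1 : ℤ) ^ ((n + 1) ^ 2) = (-1) ^ (n + 1) := by
        rw [sq, pow_mul]
        rcases Nat.even_or_odd (n + 1) with h | h <;> simp [h.neg_one_pow]
      simp [h', thetaNeg, hs, hp]
    · simp only [h.ne', if_false, mul_zero, add_zero, not_lt.2 h.le]
      split_ifs with h'
      · have hs : ¬ IsSquare d := by
          rintro ⟨r, rfl⟩
          have h1 : n + 1 < r := by by_contra!; nlinarith
          have h2 : r < n + 1 + 1 := by by_contra!; nlinarith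
          omega
        have : d ≠ 0 := by rintro rfl; simp at h
        simp [thetaNeg, hs, this]
      · rfl

lemma continuous_of_continuous_coeff {f : ℤ⟦X⟧ → ℤ⟦X⟧}
    (h : ∀ d, Continuous fun g => coeff d (f g)) : Continuous f :=
  continuous_iff_continuousAt.2 fun x =>
    (WithPiTopology.tendsto_iff_coeff_tendsto ℤ f _ _).2 fun d => (h d).tendsto x

lemma HasProd.powerSeries_expand {f : ℕ → ℤ⟦X⟧} {a : ℤ⟦X⟧} (h : HasProd f a) {k : ℕ}
    (hk : k ≠ 0) : HasProd (fun n => expand k hk (f n)) (expand k hk a) := by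
  refine h.map (expand k hk : ℤ⟦X⟧ →ₐ[ℤ] ℤ⟦X⟧) (continuous_of_continuous_coeff fun d => ?_)
  simp only [coeff_expand]
  split_ifs
  · exact WithPiTopology.continuous_coeff ℤ _
  · exact continuous_const

lemma HasProd.powerSeries_rescale {f : ℕ → ℤ⟦X⟧} {a : ℤ⟦X⟧} (h : HasProd f a) (c : ℤ) :
    HasProd (fun n => rescale c (f n)) (rescale c a) := by
  refine h.map (rescale c) (continuous_of_continuous_coeff fun d => ?_)
  simp only [coeff_rescale]
  exact continuous_const.mul (WithPiTopology.continuous_coeff ℤ _)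

/-- The Euler product `∏_{n ≥ 1} (1 - X^n)`. -/
noncomputable def eulerProd : ℤ⟦X⟧ := ∏' n : ℕ, (1 - X ^ (n + 1))

/-- The product `∏_{n odd} (1 - X^n)`. -/
noncomputable def oddProd : ℤ⟦X⟧ := ∏' n : ℕ, (1 - X ^ (2 * n + 1))

lemma hasProd_eulerProd : HasProd (fun n : ℕ => (1 - X ^ (n + 1) : ℤ⟦X⟧)) eulerProd :=
  (WithPiTopology.multipliable_one_sub_X_pow ℤ).hasProd

lemma hasProd_oddProd : HasProd (fun n : ℕ => (1 - X ^ (2 * n + 1) : ℤ⟦X⟧)) oddProd := by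
  refine Multipliable.hasProd ?_
  simp_rw [sub_eq_add_neg]
  apply WithPiTopology.multipliable_one_add_of_tendsto_order_atTop_nhds_top
  refine ENat.tendsto_nhds_top_iff_natCast_lt.mpr
    (fun n => Filter.eventually_atTop.mpr ⟨n, fun m hm => ?_⟩)
  rw [order_neg, order_X_pow]
  norm_cast
  omega

lemma hasProd_expand_eulerProd {k : ℕ} (hk : k ≠ 0) :
    HasProd (fun n : ℕ => (1 - X ^ (k * (n + 1)) : ℤ⟦X⟧)) (expand k hk eulerProd) := by
  simpa [pow_mul] using hasProd_eulerProd.powerSeries_expand hk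

lemma hasProd_expand_oddProd {k : ℕ} (hk : k ≠ 0) :
    HasProd (fun n : ℕ => (1 - X ^ (k * (2 * n + 1)) : ℤ⟦X⟧)) (expand k hk oddProd) := by
  simpa [pow_mul] using hasProd_oddProd.powerSeries_expand hk

lemma oddProd_mul_expand_eulerProd : oddProd * expand 2 two_ne_zero eulerProd = eulerProd := by
  refine HasProd.unique (HasProd.even_mul_odd (f := fun n : ℕ => (1 - X ^ (n + 1) : ℤ⟦X⟧))
    hasProd_oddProd ?_) hasProd_eulerProd
  exact hasProd_expand_eulerProd two_ne_zero

lemma oddProd_mul_rescale : oddProd * rescale (-1) oddProd = expand 2 two_ne_zero oddProd := by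
  refine HasProd.unique ?_ (hasProd_expand_oddProd two_ne_zero)
  convert hasProd_oddProd.mul (hasProd_oddProd.powerSeries_rescale (-1)) using 2 with i
  rw [map_sub, map_one, map_pow, rescale_neg_one_X, Odd.neg_pow ⟨i, rfl⟩]
  ring

lemma rescale_expand_eulerProd :
    rescale (-1) (expand 2 two_ne_zero eulerProd) = expand 2 two_ne_zero eulerProd := by
  ext d
  rw [coeff_rescale, coeff_expand]
  split_ifs with h
  · rw [(even_iff_two_dvd.2 h).neg_one_pow, one_mul]
  · simp

/-- The product formula of Gauss for `φ(-q)`. -/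
lemma thetaNeg_eq : thetaNeg = expand 2 two_ne_zero eulerProd * oddProd ^ 2 := by
  have h := ((hasProd_expand_eulerProd two_ne_zero).mul
    (hasProd_oddProd.mul hasProd_oddProd)).tendsto_prod_nat
  rw [← sq] at h
  refine tendsto_nhds_unique ?_ h
  rw [WithPiTopology.tendsto_iff_coeff_tendsto]
  refine fun d => tendsto_atTop_of_eventually_const (i₀ := d) fun n hn => ?_
  have hd := X_pow_dvd_finite_gauss n
  rw [X_pow_dvd_iff] at hd
  have := hd d (by omega)
  rw [map_sub, sub_eq_zero, coeff_sum_range_theta, if_pos (by nlinarith)] at this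
  rw [← this, prod_mul_distrib, prod_mul_distrib, qPoch, sq]

lemma expand_two_expand_two (f : ℤ⟦X⟧) :
    expand 2 two_ne_zero (expand 2 two_ne_zero f) = expand 4 four_ne_zero f :=
  (expand_mul 2 two_ne_zero 2 two_ne_zero f).symm

lemma rescale_thetaNeg_mul :
    rescale (-1) thetaNeg * thetaNeg = expand 2 two_ne_zero thetaNeg ^ 2 := by
  have h1 := oddProd_mul_rescale
  have h2 := congrArg (expand 2 two_ne_zero) oddProd_mul_expand_eulerProd
  rw [map_mul] at h2
  simp only [thetaNeg_eq, map_mul, map_pow, rescale_expand_eulerProd]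
  set P := oddProd
  set E2 := expand 2 two_ne_zero eulerProd
  calc _ = E2 ^ 2 * (P * rescale (-1) P) ^ 2 := by ring
    _ = (expand 2 two_ne_zero P * E2) ^ 2 := by rw [h1]; ring
    _ = _ := by nth_rw 1 [← h2]; ring

/-- The generating function of partitions with part `i` occurring `c` times allowed iff `Q i c`. -/
noncomputable def countGen (Q : ℕ → ℕ → Prop) [∀ i c, Decidable (Q i c)] : ℤ⟦X⟧ :=
  Nat.Partition.genFun fun i c => if Q i c then 1 else 0

lemma coeff_countGen (Q : ℕ → ℕ → Prop) [∀ i c, Decidable (Q i c)] (n : ℕ) :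
    coeff n (countGen Q) =
      Nat.card {p : n.Partition // ∀ i ∈ p.parts, Q i (p.parts.count i)} := by
  rw [countGen, Nat.Partition.coeff_genFun, Nat.card_eq_fintype_card, Fintype.card_subtype,
    card_filter]
  push_cast
  refine sum_congr rfl fun p _ => ?_
  rw [Finsupp.prod, prod_boole]
  simp

lemma hasProd_countGen (Q : ℕ → ℕ → Prop) [∀ i c, Decidable (Q i c)]
    (hQ : ∀ i c, Q i c → c < 4) :
    HasProd (fun i => 1 + ∑ j ∈ range 3,
      (if Q (i + 1) (j + 1) then (1 : ℤ) else 0) • (X : ℤ⟦X⟧) ^ ((i + 1) * (j + 1)))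
      (countGen Q) := by
  convert! Nat.Partition.hasProd_genFun (fun i c => if Q i c then (1 : ℤ) else 0) using 3 with i
  refine (tsum_eq_sum fun j hj => ?_).symm
  rw [if_neg, zero_smul]
  intro h
  have := hQ _ _ h
  simp at hj
  omega

lemma countGen_mul_eulerProd :
    countGen (fun _ c => c < 4) * eulerProd = expand 4 four_ne_zero eulerProd := by
  refine HasProd.unique ?_ (hasProd_expand_eulerProd four_ne_zero)
  convert (hasProd_countGen (fun _ c => c < 4) (by simp)).mul hasProd_eulerProd using 2 with i
  simp [sum_range_succ]
  ring

lemma countGen_odd_mul_oddProd :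
    countGen (fun i c => Odd i ∧ c < 4) * oddProd = expand 4 four_ne_zero oddProd := by
  have h (f : ℕ → ℤ⟦X⟧) (a : ℤ⟦X⟧) (hf : HasProd (fun n => f (2 * n)) a) :
      HasProd (fun n => if Even n then f n else 1) a := by
    rw [← mul_one a]
    refine HasProd.even_mul_odd ?_ ?_
    · simpa using hf
    · simp
  have h1 := h (fun n => 1 - X ^ (n + 1)) _ hasProd_oddProd
  have h4 := h (fun n => 1 - X ^ (4 * (n + 1))) _ (hasProd_expand_oddProd four_ne_zero)
  refine HasProd.unique ?_ h4
  convert (hasProd_countGen (fun i c => Odd i ∧ c < 4) (by simp)).mul h1 using 2 with i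
  by_cases hi : Even i
  · simp [sum_range_succ, hi, hi.add_one]
    ring
  · have : ¬ Odd (i + 1) := by simpa [Nat.odd_add_one] using hi
    simp [hi, this]

/-- The generating function of the pairs of partitions counted by `b`. -/
noncomputable def pairGen : ℤ⟦X⟧ :=
  countGen (fun i c => Odd i ∧ c < 4) * countGen (fun _ c => c < 4)

lemma pairGen_mul_thetaNeg : pairGen * thetaNeg = expand 4 four_ne_zero thetaNeg := by
  have h := congrArg (expand 4 four_ne_zero) oddProd_mul_expand_eulerProd
  rw [map_mul] at h
  simp only [pairGen, thetaNeg_eq, map_mul, map_pow]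
  set A := countGen fun i c => Odd i ∧ c < 4
  set B := countGen fun _ c => c < 4
  calc _ = (A * oddProd) * (B * (oddProd * expand 2 two_ne_zero eulerProd)) := by ring
    _ = expand 4 four_ne_zero oddProd * expand 4 four_ne_zero eulerProd := by
      rw [countGen_odd_mul_oddProd, oddProd_mul_expand_eulerProd, countGen_mul_eulerProd]
    _ = _ := by rw [← h]; ring

/-- The power series `∑ a(2n) X^n` attached to `∑ a(n) X^n`. -/
noncomputable def evenPart (f : ℤ⟦X⟧) : ℤ⟦X⟧ := mk fun n => coeff (2 * n) f

lemma evenPart_expand_mul (f g : ℤ⟦X⟧) :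
    evenPart (expand 2 two_ne_zero f * g) = f * evenPart g := by
  ext n
  simp only [evenPart, coeff_mk, coeff_mul]
  symm
  refine sum_of_injOn (fun p => (2 * p.1, 2 * p.2)) ?_ ?_ ?_ ?_
  · rintro ⟨a, b⟩ - ⟨c, d⟩ - h
    simp at h ⊢
    omega
  · rintro ⟨a, b⟩ h
    simp at h ⊢
    omega
  · rintro ⟨a, b⟩ h h'
    rw [coeff_expand, if_neg, zero_mul]
    rintro ⟨c, rfl⟩
    have h : 2 * c + b = 2 * n := mem_antidiagonal.1 h
    refine h' ⟨(c, b / 2), mem_coe.2 (mem_antidiagonal.2 ?_), Prod.ext rfl ?_⟩ <;> dsimp only <;>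
      omega
  · rintro ⟨a, b⟩ -
    simp [coeff_expand_mul]

lemma evenPart_rescale_thetaNeg :
    evenPart (rescale (-1) thetaNeg) = expand 2 two_ne_zero (rescale (-1) thetaNeg) := by
  have hr : ∀ d, coeff d (rescale (-1) thetaNeg) =
      if d = 0 then 1 else if IsSquare d then 2 else 0 := by
    intro d
    rw [coeff_rescale, thetaNeg, coeff_mk]
    split_ifs with h1 h2
    · simp [h1]
    · rw [mul_left_comm, ← mul_pow]; simp
    · simp
  ext n
  rw [evenPart, coeff_mk, coeff_expand, hr, hr]
  have hsq : IsSquare (2 * n) ↔ 2 ∣ n ∧ IsSquare (n / 2) := by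
    constructor
    · rintro ⟨r, h⟩
      have : 2 ∣ r := by
        have : 2 ∣ r * r := ⟨n, h.symm⟩
        rcases (Nat.prime_two.dvd_mul).1 this with h | h <;> exact h
      obtain ⟨s, rfl⟩ := this
      have : n = 2 * (s * s) := by nlinarith
      exact ⟨⟨_, this⟩, s, by omega⟩
    · rintro ⟨⟨m, rfl⟩, s, h⟩
      rw [Nat.mul_div_cancel_left _ two_pos] at h
      exact ⟨2 * s, by rw [h]; ring⟩
  by_cases h2 : 2 ∣ n
  · have : n / 2 = 0 ↔ n = 0 := by omega
    simp [hsq, h2, this]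
  · have : n ≠ 0 := by rintro rfl; simp at h2
    simp [hsq, h2, this]

lemma thetaNeg_ne_zero : thetaNeg ≠ 0 := by
  intro h
  simpa [thetaNeg] using congrArg (coeff 0) h

lemma evenPart_pairGen : evenPart pairGen = pairGen ^ 2 := by
  have h1 := pairGen_mul_thetaNeg
  have h2 := rescale_thetaNeg_mul
  have h3 : expand 2 two_ne_zero (thetaNeg ^ 2) * pairGen =
      expand 2 two_ne_zero (expand 2 two_ne_zero thetaNeg) * rescale (-1) thetaNeg := by
    rw [map_pow, ← h2, expand_two_expand_two, ← h1]; ring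
  have h4 := congrArg evenPart h3
  rw [evenPart_expand_mul, evenPart_expand_mul, evenPart_rescale_thetaNeg, ← map_mul,
    mul_comm thetaNeg, h2, map_pow, expand_two_expand_two, ← h1] at h4
  refine mul_left_cancel₀ (pow_ne_zero 2 thetaNeg_ne_zero) (h4.trans ?_)
  ring

lemma natCard_pairs (n : ℕ) :
    (Nat.card {p : Multiset ℕ × Multiset ℕ //
      OddPartitionMultAtMostThree p.1 ∧ PartitionMultAtMostThree p.2 ∧
      p.1.sum + p.2.sum = n} : ℤ) = coeff n pairGen := by
  let A (m : ℕ) := {p : m.Partition // ∀ i ∈ p.parts, Odd i ∧ p.parts.count i < 4}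
  let B (m : ℕ) := {p : m.Partition // ∀ i ∈ p.parts, p.parts.count i < 4}
  have hc : ∀ (s : Multiset ℕ), (∀ i, s.count i ≤ 3) ↔ ∀ i ∈ s, s.count i < 4 := by
    intro s
    refine ⟨fun h i _ => Nat.lt_succ_of_le (h i), fun h i => ?_⟩
    by_cases hi : i ∈ s
    · exact Nat.le_of_lt_succ (h i hi)
    · simp [Multiset.count_eq_zero_of_notMem hi]
  let e : {p : Multiset ℕ × Multiset ℕ //
      OddPartitionMultAtMostThree p.1 ∧ PartitionMultAtMostThree p.2 ∧
      p.1.sum + p.2.sum = n} ≃ Σ x : antidiagonal n, A x.1.1 × B x.1.2 :=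
    { toFun := fun p => ⟨⟨(p.1.1.sum, p.1.2.sum), mem_antidiagonal.2 p.2.2.2⟩,
        ⟨⟨p.1.1, fun hi => (p.2.1.1 _ hi).pos, rfl⟩,
          fun i hi => ⟨p.2.1.1 i hi, (hc _).1 p.2.1.2 i hi⟩⟩,
        ⟨⟨p.1.2, fun hi => p.2.2.1.1 _ hi, rfl⟩, (hc _).1 p.2.2.1.2⟩⟩
      invFun := fun x => ⟨(x.2.1.1.parts, x.2.2.1.parts),
        ⟨fun i hi => (x.2.1.2 i hi).1, (hc _).2 fun i hi => (x.2.1.2 i hi).2⟩,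
        ⟨fun i hi => x.2.2.1.parts_pos hi, (hc _).2 x.2.2.2⟩, by
          rw [x.2.1.1.parts_sum, x.2.2.1.parts_sum]; exact mem_antidiagonal.1 x.1.2⟩
      left_inv := fun p => rfl
      right_inv := by
        rintro ⟨⟨⟨a, b⟩, h⟩, ⟨⟨p, hp, hp'⟩, hA⟩, ⟨⟨q, hq, hq'⟩, hB⟩⟩
        dsimp only at hp' hq'
        subst hp' hq'
        rfl }
  rw [Nat.card_congr e, Nat.card_sigma, pairGen, coeff_mul, ← sum_coe_sort (antidiagonal n)]
  push_cast
  refine sum_congr rfl fun x _ => ?_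
  rw [coeff_countGen, coeff_countGen, Nat.card_prod]
  push_cast
  rfl

/-- If `b n` is the number of pairs `(λ, μ)` where `λ` is a partition into odd parts with
each part size occurring at most three times, `μ` is a partition with each part size
occurring at most three times, and `|λ| + |μ| = n` (OEIS A103258), then `b` is
`2`-convolutive: `b (2n) = ∑_{i=0}^{n} b i * b (n - i)`. -/
theorem A103258_two_convolutive (b : ℕ → ℕ)
    (hb : ∀ n, b n = Nat.card {p : Multiset ℕ × Multiset ℕ //
      OddPartitionMultAtMostThree p.1 ∧ PartitionMultAtMostThree p.2 ∧
      p.1.sum + p.2.sum = n}) :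
    ∀ n, b (2 * n) = ∑ i ∈ Finset.range (n + 1), b i * b (n - i) := by
  intro n
  have hb' : ∀ m, (b m : ℤ) = coeff m pairGen := fun m => by rw [hb m, natCard_pairs]
  have h : coeff (2 * n) pairGen = coeff n (pairGen ^ 2) := by
    rw [← evenPart_pairGen, evenPart, coeff_mk]
  rw [sq, coeff_mul, Nat.sum_antidiagonal_eq_sum_range_succ
    (fun i j => coeff i pairGen * coeff j pairGen)] at h
  simp only [← hb'] at h
  exact_mod_cast h
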